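/- arXiv:2109.14961 — 3 statements merged into one kernel-verified Lean document; each statement's English description precedes it below -/
import Mathlib

section
/- In the local model S(t) for a bounded edge e of C contained in an edge e′ of C′ (see context), suppose δ₁⁰·δ₄⁰·(−ε₁⁰·ε₂⁰)^(n+s) < 0 (the edge e is twisted). Then there exists t₀ > 0 such that for every t ∈ (0, t₀), the set S(t) has exactly two elements, and both elements lie in ℝ × ℝ (i.e., the intersection consists of two distinct real points of multiplicity 1). -/
open Filter Topology

/-- Local model for the intersection of realisations of two non-singular real
tropical curves, where a bounded edge `e` of `C` (of lattice length `b`, with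
vertices `(0,0)` and `(b,b)`) is contained in the interior of an edge `e'` of
`C'`. -/
noncomputable def Sloc (b : ℝ) (m n p q r s : ℕ)
    (ε₁ ε₂ δ₁ δ₂ δ₃ δ₄ : ℝ → ℝ) (t : ℝ) : Set (ℂ × ℂ) :=
  {zw : ℂ × ℂ | zw.1 ≠ 0 ∧ zw.2 ≠ 0 ∧
    (ε₁ t : ℂ) * zw.1 + (ε₂ t : ℂ) * zw.2 = 0 ∧
    (δ₁ t : ℂ) * ((t ^ b : ℝ) : ℂ) * zw.1 ^ m * zw.2 ^ n
      + (δ₂ t : ℂ) * zw.1 ^ (p + 1) * zw.2 ^ q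
      + (δ₃ t : ℂ) * zw.1 ^ p * zw.2 ^ (q + 1)
      + (δ₄ t : ℂ) * zw.1 ^ r * zw.2 ^ s = 0}


/-- A real quadratic whose leading and constant coefficients have opposite signs has exactly two
complex roots, and they are real, distinct and nonzero. -/
theorem exists_real_roots_of_mul_neg {a b c : ℝ} (h : a * c < 0) :
    ∃ x y : ℝ, x ≠ y ∧ x ≠ 0 ∧ y ≠ 0 ∧
      ∀ z : ℂ, (a : ℂ) * (z * z) + b * z + c = 0 ↔ z = x ∨ z = y := by
  have ha : a ≠ 0 := left_ne_zero_of_mul h.ne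
  have hc : c ≠ 0 := right_ne_zero_of_mul h.ne
  have hd : 0 < discrim a b c := by
    unfold discrim
    nlinarith [sq_nonneg b]
  have hs : discrim a b c = √(discrim a b c) * √(discrim a b c) :=
    (Real.mul_self_sqrt hd.le).symm
  have hpos := Real.sqrt_pos.mpr hd
  set σ := √(discrim a b c)
  have hroot := fun x => quadratic_eq_zero_iff ha hs x
  have hne : ∀ x : ℝ, a * (x * x) + b * x + c = 0 → x ≠ 0 := by
    rintro x hx rfl
    exact hc (by simpa using hx)
  refine ⟨(-b + σ) / (2 * a), (-b - σ) / (2 * a), ?_, hne _ ((hroot _).2 (.inl rfl)),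
    hne _ ((hroot _).2 (.inr rfl)), fun z => ?_⟩
  · intro hxy
    rw [div_left_inj' (by simpa using ha)] at hxy
    linarith
  · have hs' : discrim (a : ℂ) b c = (σ : ℂ) * σ := by
      rw [← Complex.ofReal_mul, ← hs]
      simp [discrim]
    rw [quadratic_eq_zero_iff (Complex.ofReal_ne_zero.2 ha) hs']
    push_cast
    rfl

/-- The local intersection is cut out on the line `w = k z` by a quadratic in `z`. -/
theorem mem_Sloc_iff {b : ℝ} {m n p q r s : ℕ}
    (h1 : m + n = p + q + 2) (h2 : m + n = r + s + 2)
    {ε₁ ε₂ δ₁ δ₂ δ₃ δ₄ : ℝ → ℝ} {t : ℝ} (hε₁ : ε₁ t ≠ 0) (hε₂ : ε₂ t ≠ 0)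
    {k : ℝ} (hk : k = -ε₁ t / ε₂ t) (zw : ℂ × ℂ) :
    zw ∈ Sloc b m n p q r s ε₁ ε₂ δ₁ δ₂ δ₃ δ₄ t ↔
      zw.1 ≠ 0 ∧ zw.2 = k * zw.1 ∧
        ((δ₁ t * t ^ b * k ^ n : ℝ) : ℂ) * (zw.1 * zw.1)
          + ((δ₂ t * k ^ q + δ₃ t * k ^ (q + 1) : ℝ) : ℂ) * zw.1
          + ((δ₄ t * k ^ s : ℝ) : ℂ) = 0 := by
  obtain ⟨z, w⟩ := zw
  have hk0 : (k : ℂ) ≠ 0 := by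
    rw [hk]
    exact_mod_cast div_ne_zero (neg_ne_zero.2 hε₁) hε₂
  have hε₂' : (ε₂ t : ℂ) ≠ 0 := Complex.ofReal_ne_zero.2 hε₂
  have hline : (ε₁ t : ℂ) * z + ε₂ t * w = 0 ↔ w = k * z := by
    rw [hk]
    push_cast
    constructor
    · intro h
      field_simp
      linear_combination h
    · rintro rfl
      field_simp
      ring
  have hfactor :
      (δ₁ t : ℂ) * ((t ^ b : ℝ) : ℂ) * z ^ m * (k * z) ^ n
        + (δ₂ t : ℂ) * z ^ (p + 1) * (k * z) ^ q
        + (δ₃ t : ℂ) * z ^ p * (k * z) ^ (q + 1)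
        + (δ₄ t : ℂ) * z ^ r * (k * z) ^ s =
      z ^ (r + s) * (((δ₁ t * t ^ b * k ^ n : ℝ) : ℂ) * (z * z)
          + ((δ₂ t * k ^ q + δ₃ t * k ^ (q + 1) : ℝ) : ℂ) * z
          + ((δ₄ t * k ^ s : ℝ) : ℂ)) := by
    have hmn : z ^ m * z ^ n = z ^ (r + s) * (z * z) := by
      rw [← pow_add, h2]
      ring
    have hpq : z ^ p * z ^ q = z ^ (r + s) := by
      rw [← pow_add, show p + q = r + s by omega]
    push_cast
    simp only [mul_pow, pow_succ]
    linear_combination (δ₁ t * ((t ^ b : ℝ) : ℂ) * k ^ n) * hmn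
      + ((δ₂ t * k ^ q + δ₃ t * (k ^ q * k)) * z) * hpq
  simp only [Sloc, Set.mem_ofPred_eq]
  rw [hline]
  constructor
  · rintro ⟨hz, -, rfl, h⟩
    rw [hfactor] at h
    exact ⟨hz, rfl, (mul_eq_zero.1 h).resolve_left (pow_ne_zero _ hz)⟩
  · rintro ⟨hz, rfl, h⟩
    exact ⟨hz, mul_ne_zero hk0 hz, rfl, by rw [hfactor, h, mul_zero]⟩

/-- The outer coefficients of the quadratic have opposite signs under the twist condition. -/
theorem twisted_coeff_mul_neg {e₁ e₂ d₁ d₄ T : ℝ} {n s : ℕ} (he₂ : e₂ ≠ 0) (hT : 0 < T)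
    (h : d₁ * d₄ * (-(e₁ * e₂)) ^ (n + s) < 0) :
    (d₁ * T * (-e₁ / e₂) ^ n) * (d₄ * (-e₁ / e₂) ^ s) < 0 := by
  have hpos : 0 < T / (e₂ ^ 2) ^ (n + s) := by positivity
  have hratio : -e₁ / e₂ = -(e₁ * e₂) / e₂ ^ 2 := by
    field_simp
  calc (d₁ * T * (-e₁ / e₂) ^ n) * (d₄ * (-e₁ / e₂) ^ s)
      = d₁ * d₄ * T * (-e₁ / e₂) ^ (n + s) := by ring
    _ = d₁ * d₄ * (-(e₁ * e₂)) ^ (n + s) * (T / (e₂ ^ 2) ^ (n + s)) := by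
        rw [hratio, div_pow]
        ring
    _ < 0 := mul_neg_of_neg_of_pos h hpos

/-- If the edge `e` is twisted (`δ₁⁰·δ₄⁰·(−ε₁⁰·ε₂⁰)^(n+s) < 0`), then for all
small `t > 0` the intersection consists of exactly two points, both real. -/
theorem edge_in_edge_twisted_two_real_points
    (b : ℝ) (hb : 0 < b) (m n p q r s : ℕ)
    (h1 : m + n = p + q + 2) (h2 : m + n = r + s + 2)
    (ε₁ ε₂ δ₁ δ₂ δ₃ δ₄ : ℝ → ℝ) (ε₁0 ε₂0 δ₁0 δ₂0 δ₃0 δ₄0 : ℝ)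
    (hε₁ : Tendsto ε₁ (𝓝[>] 0) (𝓝 ε₁0)) (hε₁0 : ε₁0 ≠ 0)
    (hε₂ : Tendsto ε₂ (𝓝[>] 0) (𝓝 ε₂0)) (hε₂0 : ε₂0 ≠ 0)
    (hδ₁ : Tendsto δ₁ (𝓝[>] 0) (𝓝 δ₁0)) (hδ₁0 : δ₁0 ≠ 0)
    (hδ₂ : Tendsto δ₂ (𝓝[>] 0) (𝓝 δ₂0)) (hδ₂0 : δ₂0 ≠ 0)
    (hδ₃ : Tendsto δ₃ (𝓝[>] 0) (𝓝 δ₃0)) (hδ₃0 : δ₃0 ≠ 0)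
    (hδ₄ : Tendsto δ₄ (𝓝[>] 0) (𝓝 δ₄0)) (hδ₄0 : δ₄0 ≠ 0)
    (hsign : δ₁0 * δ₄0 * (-(ε₁0 * ε₂0)) ^ (n + s) < 0) :
    ∃ t₀ > (0 : ℝ), ∀ t : ℝ, 0 < t → t < t₀ →
      (Sloc b m n p q r s ε₁ ε₂ δ₁ δ₂ δ₃ δ₄ t).ncard = 2 ∧
      ∀ zw ∈ Sloc b m n p q r s ε₁ ε₂ δ₁ δ₂ δ₃ δ₄ t,
        zw.1.im = 0 ∧ zw.2.im = 0 := by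
  have hsign' : ∀ᶠ t in 𝓝[>] (0 : ℝ), δ₁ t * δ₄ t * (-(ε₁ t * ε₂ t)) ^ (n + s) < 0 :=
    ((hδ₁.mul hδ₄).mul ((hε₁.mul hε₂).neg.pow (n + s))).eventually_lt_const hsign
  obtain ⟨t₀, ht₀, hsub⟩ := mem_nhdsGT_iff_exists_Ioo_subset.1
    ((hε₁.eventually_ne hε₁0).and ((hε₂.eventually_ne hε₂0).and hsign'))
  refine ⟨t₀, ht₀, fun t ht htt₀ => ?_⟩
  obtain ⟨he₁, he₂, hs⟩ := hsub ⟨ht, htt₀⟩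
  obtain ⟨x, y, hxy, hx, hy, hroots⟩ := exists_real_roots_of_mul_neg
    (b := δ₂ t * (-ε₁ t / ε₂ t) ^ q + δ₃ t * (-ε₁ t / ε₂ t) ^ (q + 1))
    (twisted_coeff_mul_neg he₂ (Real.rpow_pos_of_pos ht b) hs)
  have hS : Sloc b m n p q r s ε₁ ε₂ δ₁ δ₂ δ₃ δ₄ t =
      {((x : ℂ), ((-ε₁ t / ε₂ t : ℝ) : ℂ) * x), ((y : ℂ), ((-ε₁ t / ε₂ t : ℝ) : ℂ) * y)} := by
    ext ⟨z, w⟩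
    rw [mem_Sloc_iff h1 h2 he₁ he₂ rfl, hroots]
    simp only [Set.mem_insert_iff, Set.mem_singleton_iff, Prod.mk.injEq]
    constructor
    · rintro ⟨-, rfl, rfl | rfl⟩ <;> simp
    · rintro (⟨rfl, rfl⟩ | ⟨rfl, rfl⟩) <;> simp [hx, hy]
  rw [hS]
  refine ⟨Set.ncard_pair fun h => hxy (Complex.ofReal_injective (Prod.mk.inj h).1), ?_⟩
  rintro zw (rfl | rfl) <;> exact ⟨Complex.ofReal_im _, by rw [← Complex.ofReal_mul, Complex.ofReal_im]⟩
end

section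
/- In the local model S(t) for a segment E strictly contained in edges e of C and e′ of C′ (see context), suppose δ₂⁰·δ₃⁰·ε₁⁰·ε₂⁰ < 0 (the real phase structures on e and e′ are distinct). Then there exist t₀ > 0 and functions z₁, z₂ : (0, t₀) → ℝ such that for every t ∈ (0, t₀): the set S(t) has exactly two elements, both lying in ℝ × ℝ, namely (z₁(t), w₁(t)) and (z₂(t), w₂(t)) with wᵢ(t) := −(ε₀(t) + ε₁(t)·zᵢ(t))/ε₂(t) and (z₁(t), w₁(t)) ≠ (z₂(t), w₂(t)); moreover, as t → 0⁺, z₁(t) → δ₃⁰·ε₀⁰/(δ₂⁰·ε₂⁰ − δ₃⁰·ε₁⁰) and w₁(t) → −δ₂⁰·ε₀⁰/(δ₂⁰·ε₂⁰ − δ₃⁰·ε₁⁰) (both nonzero), and t^b·z₂(t) and t^b·w₂(t) converge to nonzero real limits. In other words, the two real intersection points have tropicalisations converging to the two vertices (0,0) and (b,b) of the segment E. -/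
open Filter Topology

/-- Local model for the intersection of realisations of two non-singular real
tropical curves, where a segment `E` with vertices `(0,0)` and `(b,b)` is
strictly contained in both a closed edge `e` of `C` and a closed edge `e'`
of `C'`. -/
noncomputable def Sloc2 (b : ℝ) (m n p q : ℕ)
    (ε₀ ε₁ ε₂ δ₁ δ₂ δ₃ : ℝ → ℝ) (t : ℝ) : Set (ℂ × ℂ) :=
  {zw : ℂ × ℂ | zw.1 ≠ 0 ∧ zw.2 ≠ 0 ∧
    (ε₀ t : ℂ) + (ε₁ t : ℂ) * zw.1 + (ε₂ t : ℂ) * zw.2 = 0 ∧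
    (δ₁ t : ℂ) * ((t ^ b : ℝ) : ℂ) * zw.1 ^ m * zw.2 ^ n
      + (δ₂ t : ℂ) * zw.1 ^ (p + 1) * zw.2 ^ q
      + (δ₃ t : ℂ) * zw.1 ^ p * zw.2 ^ (q + 1) = 0}

/-- Over `ℝ`, a quadratic equation whose leading coefficient degenerates to zero has, in the limit,
one root converging to the root of the limiting linear equation and one root escaping to infinity.
Both roots are real and there are no further complex roots. -/
theorem exists_roots_of_degenerating_quadratic {l : Filter ℝ} {a B C : ℝ → ℝ} {B₀ C₀ : ℝ}
    (ha : Tendsto a l (𝓝 0)) (ha0 : ∀ᶠ t in l, a t ≠ 0)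
    (hB : Tendsto B l (𝓝 B₀)) (hB₀ : B₀ ≠ 0) (hC : Tendsto C l (𝓝 C₀)) :
    ∃ z₁ z₂ : ℝ → ℝ,
      (∀ᶠ t in l, z₁ t ≠ z₂ t) ∧
      (∀ᶠ t in l, ∀ z : ℂ,
        (a t : ℂ) * z ^ 2 + (B t : ℂ) * z + (C t : ℂ) = 0 ↔ z = z₁ t ∨ z = z₂ t) ∧
      Tendsto z₁ l (𝓝 (-C₀ / B₀)) ∧
      Tendsto (fun t => a t * z₂ t) l (𝓝 (-B₀)) := by
  set D : ℝ → ℝ := fun t => 1 - 4 * (a t * C t) / B t ^ 2 with hD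
  set r : ℝ → ℝ := fun t => (1 + √(D t)) / 2 with hr
  have hDlim : Tendsto D l (𝓝 1) := by
    have h := (((ha.mul hC).const_mul 4).div (hB.pow 2) (pow_ne_zero 2 hB₀)).const_sub 1
    simpa using h
  have hrlim : Tendsto r l (𝓝 1) := by
    have h := ((hDlim.sqrt).const_add 1).div_const 2
    norm_num at h
    exact h
  have hz₁ : Tendsto (fun t => -C t / (B t * r t)) l (𝓝 (-C₀ / B₀)) := by
    have h := hC.neg.div (hB.mul hrlim) (by simpa using hB₀)
    rwa [mul_one] at h
  have hz₂ : Tendsto (fun t => a t * (-(B t * r t) / a t)) l (𝓝 (-B₀)) := by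
    have h : Tendsto (fun t => -(B t * r t)) l (𝓝 (-B₀)) := by simpa using (hB.mul hrlim).neg
    refine h.congr' ?_
    filter_upwards [ha0] with t ht
    field_simp
  refine ⟨fun t => -C t / (B t * r t), fun t => -(B t * r t) / a t, ?_, ?_, hz₁, hz₂⟩
  · have h : Tendsto (fun t => a t * (-C t / (B t * r t)) - a t * (-(B t * r t) / a t)) l
        (𝓝 B₀) := by simpa using (ha.mul hz₁).sub hz₂
    filter_upwards [h.eventually_ne hB₀] with t ht heq
    exact ht (by rw [heq, sub_self])
  · filter_upwards [ha0, hB.eventually_ne hB₀, hrlim.eventually_ne one_ne_zero,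
      hDlim.eventually (lt_mem_nhds zero_lt_one)] with t hat hBt hrt hDt z
    have hsq : √(D t) ^ 2 = D t := Real.sq_sqrt hDt.le
    have hquad : B t ^ 2 * r t ^ 2 = B t ^ 2 * r t - a t * C t := by
      have h2 : √(D t) = 2 * r t - 1 := by simp only [hr]; ring
      rw [h2] at hsq
      simp only [hD] at hsq
      field_simp at hsq
      linear_combination hsq / 4
    have hquadC : (B t : ℂ) ^ 2 * (r t : ℂ) ^ 2 = (B t : ℂ) ^ 2 * r t - a t * C t := by
      exact_mod_cast hquad
    have ha' : (a t : ℂ) ≠ 0 := by exact_mod_cast hat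
    have hB' : (B t : ℂ) ≠ 0 := by exact_mod_cast hBt
    have hr' : (r t : ℂ) ≠ 0 := by exact_mod_cast hrt
    have hfac : (a t : ℂ) * z ^ 2 + (B t : ℂ) * z + (C t : ℂ) =
        a t * ((z - ((-C t / (B t * r t) : ℝ) : ℂ)) * (z - ((-(B t * r t) / a t : ℝ) : ℂ))) := by
      push_cast
      field_simp
      linear_combination (-z) * hquadC
    rw [hfac, mul_eq_zero, mul_eq_zero, sub_eq_zero, sub_eq_zero]
    simp [ha']

/-- Restricting a monomial of degree two to a line gives a quadratic polynomial with coefficients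
depending continuously on the line. -/
theorem exists_continuous_coeffs_of_degree_two {i j : ℕ} (hij : i + j = 2) :
    ∃ F G : ℝ × ℝ → ℝ, Continuous F ∧ Continuous G ∧ ∀ (α β : ℝ) (z : ℂ),
      z ^ i * (α + β * z) ^ j = (β : ℂ) ^ j * z ^ 2 + (F (α, β) : ℂ) * z + (G (α, β) : ℂ) := by
  obtain ⟨rfl, rfl⟩ | ⟨rfl, rfl⟩ | ⟨rfl, rfl⟩ :
      (i = 2 ∧ j = 0) ∨ (i = 1 ∧ j = 1) ∨ (i = 0 ∧ j = 2) := by omega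
  · exact ⟨fun _ => 0, fun _ => 0, by fun_prop, by fun_prop, fun α β z => by simp⟩
  · exact ⟨fun x => x.1, fun _ => 0, by fun_prop, by fun_prop, fun α β z => by
      push_cast; ring⟩
  · exact ⟨fun x => 2 * x.1 * x.2, fun x => x.1 ^ 2, by fun_prop, by fun_prop, fun α β z => by
      push_cast; ring⟩

/-- If the real phase structures on `e` and `e'` are distinct
(`δ₂⁰·δ₃⁰·ε₁⁰·ε₂⁰ < 0`), then for small `t > 0` the intersection consists of
exactly two real points, tropicalising to the two vertices `(0,0)` and `(b,b)`
of the segment `E`. -/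
theorem segment_distinct_phases_points_at_vertices
    (b : ℝ) (hb : 0 < b) (m n p q : ℕ)
    (h1 : m + n = p + q + 2) (hmp : p ≤ m) (hnq : q ≤ n)
    (ε₀ ε₁ ε₂ δ₁ δ₂ δ₃ : ℝ → ℝ) (ε₀0 ε₁0 ε₂0 δ₁0 δ₂0 δ₃0 : ℝ)
    (hε₀ : Tendsto ε₀ (𝓝[>] 0) (𝓝 ε₀0)) (hε₀0 : ε₀0 ≠ 0)
    (hε₁ : Tendsto ε₁ (𝓝[>] 0) (𝓝 ε₁0)) (hε₁0 : ε₁0 ≠ 0)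
    (hε₂ : Tendsto ε₂ (𝓝[>] 0) (𝓝 ε₂0)) (hε₂0 : ε₂0 ≠ 0)
    (hδ₁ : Tendsto δ₁ (𝓝[>] 0) (𝓝 δ₁0)) (hδ₁0 : δ₁0 ≠ 0)
    (hδ₂ : Tendsto δ₂ (𝓝[>] 0) (𝓝 δ₂0)) (hδ₂0 : δ₂0 ≠ 0)
    (hδ₃ : Tendsto δ₃ (𝓝[>] 0) (𝓝 δ₃0)) (hδ₃0 : δ₃0 ≠ 0)
    (hsign : δ₂0 * δ₃0 * ε₁0 * ε₂0 < 0) :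
    ∃ t₀ > (0 : ℝ), ∃ z₁ z₂ : ℝ → ℝ,
      (∀ t : ℝ, 0 < t → t < t₀ →
        ((z₁ t : ℂ), ((-(ε₀ t + ε₁ t * z₁ t) / ε₂ t : ℝ) : ℂ)) ≠
          ((z₂ t : ℂ), ((-(ε₀ t + ε₁ t * z₂ t) / ε₂ t : ℝ) : ℂ)) ∧
        Sloc2 b m n p q ε₀ ε₁ ε₂ δ₁ δ₂ δ₃ t =
          {((z₁ t : ℂ), ((-(ε₀ t + ε₁ t * z₁ t) / ε₂ t : ℝ) : ℂ)),
           ((z₂ t : ℂ), ((-(ε₀ t + ε₁ t * z₂ t) / ε₂ t : ℝ) : ℂ))}) ∧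
      Tendsto z₁ (𝓝[>] 0) (𝓝 (δ₃0 * ε₀0 / (δ₂0 * ε₂0 - δ₃0 * ε₁0))) ∧
      δ₃0 * ε₀0 / (δ₂0 * ε₂0 - δ₃0 * ε₁0) ≠ 0 ∧
      Tendsto (fun t : ℝ => -(ε₀ t + ε₁ t * z₁ t) / ε₂ t) (𝓝[>] 0)
        (𝓝 (-(δ₂0 * ε₀0) / (δ₂0 * ε₂0 - δ₃0 * ε₁0))) ∧
      -(δ₂0 * ε₀0) / (δ₂0 * ε₂0 - δ₃0 * ε₁0) ≠ 0 ∧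
      (∃ L₁ : ℝ, L₁ ≠ 0 ∧
        Tendsto (fun t : ℝ => t ^ b * z₂ t) (𝓝[>] 0) (𝓝 L₁)) ∧
      (∃ L₂ : ℝ, L₂ ≠ 0 ∧
        Tendsto (fun t : ℝ => t ^ b * (-(ε₀ t + ε₁ t * z₂ t) / ε₂ t))
          (𝓝[>] 0) (𝓝 L₂)) := by
  obtain ⟨i, rfl⟩ := Nat.exists_eq_add_of_le hmp
  obtain ⟨j, rfl⟩ := Nat.exists_eq_add_of_le hnq
  have hij : i + j = 2 := by omega
  obtain ⟨F, G, hF, hG, hFG⟩ := exists_continuous_coeffs_of_degree_two hij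
  set α : ℝ → ℝ := fun t => -ε₀ t / ε₂ t with hα_def
  set β : ℝ → ℝ := fun t => -ε₁ t / ε₂ t with hβ_def
  have hα : Tendsto α (𝓝[>] 0) (𝓝 (-ε₀0 / ε₂0)) := hε₀.neg.div hε₂ hε₂0
  have hβ : Tendsto β (𝓝[>] 0) (𝓝 (-ε₁0 / ε₂0)) := hε₁.neg.div hε₂ hε₂0
  have hβ0 : -ε₁0 / ε₂0 ≠ 0 := div_ne_zero (neg_ne_zero.mpr hε₁0) hε₂0
  have hT : Tendsto (fun t : ℝ => t ^ b) (𝓝[>] 0) (𝓝 0) := by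
    have h := (Real.continuousAt_rpow_const 0 b (Or.inr hb.le)).tendsto
    rw [Real.zero_rpow hb.ne'] at h
    exact h.mono_left nhdsWithin_le_nhds
  have hTpos : ∀ᶠ t : ℝ in 𝓝[>] 0, 0 < t ^ b := by
    filter_upwards [self_mem_nhdsWithin] with t ht using Real.rpow_pos_of_pos ht b
  have hA : Tendsto (fun t => δ₁ t * β t ^ j) (𝓝[>] 0) (𝓝 (δ₁0 * (-ε₁0 / ε₂0) ^ j)) :=
    hδ₁.mul (hβ.pow j)
  have hA0 : δ₁0 * (-ε₁0 / ε₂0) ^ j ≠ 0 := mul_ne_zero hδ₁0 (pow_ne_zero j hβ0)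
  have hαβ := hα.prodMk_nhds hβ
  have hF' : Tendsto (fun t => F (α t, β t)) (𝓝[>] 0) _ := (hF.tendsto _).comp hαβ
  have hG' : Tendsto (fun t => G (α t, β t)) (𝓝[>] 0) _ := (hG.tendsto _).comp hαβ
  have hΔ : δ₂0 * ε₂0 - δ₃0 * ε₁0 ≠ 0 := by
    intro h
    have h' : δ₂0 * ε₂0 = δ₃0 * ε₁0 := sub_eq_zero.mp h
    have h'' : δ₂0 * δ₃0 * ε₁0 * ε₂0 = (δ₃0 * ε₁0) ^ 2 := by
      linear_combination (δ₃0 * ε₁0) * h'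
    exact absurd hsign (h'' ▸ (sq_nonneg _).not_gt)
  have hB : Tendsto (fun t => δ₂ t + δ₃ t * β t + t ^ b * (δ₁ t * F (α t, β t))) (𝓝[>] 0)
      (𝓝 ((δ₂0 * ε₂0 - δ₃0 * ε₁0) / ε₂0)) := by
    have h := (hδ₂.add (hδ₃.mul hβ)).add (hT.mul (hδ₁.mul hF'))
    rw [zero_mul, add_zero] at h
    convert h using 2
    field_simp
    ring
  have hC : Tendsto (fun t => δ₃ t * α t + t ^ b * (δ₁ t * G (α t, β t))) (𝓝[>] 0)
      (𝓝 (-(δ₃0 * ε₀0) / ε₂0)) := by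
    have h := (hδ₃.mul hα).add (hT.mul (hδ₁.mul hG'))
    rw [zero_mul, add_zero] at h
    convert h using 2
    ring
  have hB0 : (δ₂0 * ε₂0 - δ₃0 * ε₁0) / ε₂0 ≠ 0 := div_ne_zero hΔ hε₂0
  obtain ⟨z₁, z₂, hne, hroots, hz₁, hz₂⟩ := exists_roots_of_degenerating_quadratic
    (a := fun t => δ₁ t * β t ^ j * t ^ b) (by simpa using hA.mul hT)
    (by filter_upwards [hA.eventually_ne hA0, hTpos] with t h h' using mul_ne_zero h h'.ne')
    hB hB0 hC
  have hz₁' : Tendsto z₁ (𝓝[>] 0) (𝓝 (δ₃0 * ε₀0 / (δ₂0 * ε₂0 - δ₃0 * ε₁0))) := by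
    convert hz₁ using 2
    field_simp
  have hz₁0 : δ₃0 * ε₀0 / (δ₂0 * ε₂0 - δ₃0 * ε₁0) ≠ 0 :=
    div_ne_zero (mul_ne_zero hδ₃0 hε₀0) hΔ
  have hw₁ : Tendsto (fun t : ℝ => -(ε₀ t + ε₁ t * z₁ t) / ε₂ t) (𝓝[>] 0)
      (𝓝 (-(δ₂0 * ε₀0) / (δ₂0 * ε₂0 - δ₃0 * ε₁0))) := by
    have h : Tendsto (fun t : ℝ => -(ε₀ t + ε₁ t * z₁ t) / ε₂ t) (𝓝[>] 0) _ :=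
      (hε₀.add (hε₁.mul hz₁')).neg.div hε₂ hε₂0
    convert h using 2
    field_simp
    ring
  have hw₁0 : -(δ₂0 * ε₀0) / (δ₂0 * ε₂0 - δ₃0 * ε₁0) ≠ 0 :=
    div_ne_zero (neg_ne_zero.mpr (mul_ne_zero hδ₂0 hε₀0)) hΔ
  obtain ⟨L, hL0, hL⟩ : ∃ L : ℝ, L ≠ 0 ∧
      Tendsto (fun t : ℝ => t ^ b * z₂ t) (𝓝[>] 0) (𝓝 L) := by
    refine ⟨_, div_ne_zero (neg_ne_zero.mpr hB0) hA0, (hz₂.div hA hA0).congr' ?_⟩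
    filter_upwards [hA.eventually_ne hA0] with t ht
    simp only [Pi.div_apply]
    rw [div_eq_iff ht]
    ring
  have hw₂ : Tendsto (fun t : ℝ => t ^ b * (-(ε₀ t + ε₁ t * z₂ t) / ε₂ t)) (𝓝[>] 0)
      (𝓝 (-ε₁0 / ε₂0 * L)) := by
    convert (hT.mul hα).add (hβ.mul hL) using 2
    · simp only [hα_def, hβ_def]
      ring
    · ring
  have hw₂0 : -ε₁0 / ε₂0 * L ≠ 0 := mul_ne_zero hβ0 hL0
  have hall : ∀ᶠ t : ℝ in 𝓝[>] 0,
      ((z₁ t : ℂ), ((-(ε₀ t + ε₁ t * z₁ t) / ε₂ t : ℝ) : ℂ)) ≠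
          ((z₂ t : ℂ), ((-(ε₀ t + ε₁ t * z₂ t) / ε₂ t : ℝ) : ℂ)) ∧
        Sloc2 b (p + i) (q + j) p q ε₀ ε₁ ε₂ δ₁ δ₂ δ₃ t =
          {((z₁ t : ℂ), ((-(ε₀ t + ε₁ t * z₁ t) / ε₂ t : ℝ) : ℂ)),
           ((z₂ t : ℂ), ((-(ε₀ t + ε₁ t * z₂ t) / ε₂ t : ℝ) : ℂ))} := by
    filter_upwards [hne, hroots, hε₂.eventually_ne hε₂0, hz₁'.eventually_ne hz₁0,
      hw₁.eventually_ne hw₁0, hL.eventually_ne hL0, hw₂.eventually_ne hw₂0]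
      with t hnet hrt hε₂t hz₁t hw₁t hz₂t hw₂t
    replace hz₂t := right_ne_zero_of_mul hz₂t
    replace hw₂t := right_ne_zero_of_mul hw₂t
    have hε₂C : (ε₂ t : ℂ) ≠ 0 := by exact_mod_cast hε₂t
    have hline : ∀ z w : ℂ, (ε₀ t : ℂ) + ε₁ t * z + ε₂ t * w = 0 ↔ w = α t + β t * z := by
      intro z w
      simp only [hα_def, hβ_def]
      push_cast
      field_simp
      constructor <;> intro h <;> linear_combination h
    have hreal : ∀ x : ℝ, ((-(ε₀ t + ε₁ t * x) / ε₂ t : ℝ) : ℂ) = α t + β t * x := by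
      intro x
      rw [← hline]
      push_cast
      field_simp
      ring
    have hcurve : ∀ z w : ℂ, w = α t + β t * z →
        (δ₁ t : ℂ) * ((t ^ b : ℝ) : ℂ) * z ^ (p + i) * w ^ (q + j)
          + (δ₂ t : ℂ) * z ^ (p + 1) * w ^ q + (δ₃ t : ℂ) * z ^ p * w ^ (q + 1) =
        z ^ p * w ^ q * (((δ₁ t * β t ^ j * t ^ b : ℝ) : ℂ) * z ^ 2
          + ((δ₂ t + δ₃ t * β t + t ^ b * (δ₁ t * F (α t, β t)) : ℝ) : ℂ) * z
          + ((δ₃ t * α t + t ^ b * (δ₁ t * G (α t, β t)) : ℝ) : ℂ)) := by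
      intro z w hw
      have h := hFG (α t) (β t) z
      rw [← hw] at h
      have h3 : (δ₃ t : ℂ) * w = δ₃ t * (α t + β t * z) := by rw [hw]
      simp only [Complex.ofReal_add, Complex.ofReal_mul, Complex.ofReal_pow]
      linear_combination (z ^ p * w ^ q * δ₁ t * ((t ^ b : ℝ) : ℂ)) * h + z ^ p * w ^ q * h3
    refine ⟨fun h => hnet (Complex.ofReal_injective (Prod.ext_iff.mp h).1), ?_⟩
    ext ⟨z, w⟩
    simp only [Sloc2, Set.mem_ofPred_eq, Set.mem_insert_iff, Set.mem_singleton_iff, Prod.mk.injEq]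
    constructor
    · rintro ⟨hz, hw, hl, hc⟩
      rw [hline] at hl
      rw [hcurve z w hl, mul_eq_zero, hrt z] at hc
      rcases hc.resolve_left (mul_ne_zero (pow_ne_zero p hz) (pow_ne_zero q hw)) with rfl | rfl
      · exact Or.inl ⟨rfl, by rw [hl, hreal]⟩
      · exact Or.inr ⟨rfl, by rw [hl, hreal]⟩
    · rintro (⟨rfl, rfl⟩ | ⟨rfl, rfl⟩)
      · refine ⟨by exact_mod_cast hz₁t, by exact_mod_cast hw₁t, (hline _ _).mpr (hreal _), ?_⟩
        rw [hcurve _ _ (hreal _), (hrt _).mpr (Or.inl rfl), mul_zero]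
      · refine ⟨by exact_mod_cast hz₂t, by exact_mod_cast hw₂t, (hline _ _).mpr (hreal _), ?_⟩
        rw [hcurve _ _ (hreal _), (hrt _).mpr (Or.inr rfl), mul_zero]
  obtain ⟨t₀, ht₀, hsub⟩ := mem_nhdsGT_iff_exists_Ioo_subset.mp hall
  exact ⟨t₀, ht₀, z₁, z₂, fun t h h' => hsub ⟨h, h'⟩, hz₁', hz₁0, hw₁, hw₁0, ⟨L, hL0, hL⟩,
    ⟨_, hw₂0, hw₂⟩⟩
end

section
/- In the local model S(t) for a segment E strictly contained in edges e of C and e′ of C′ (see context), suppose Π > 0 (the segment E is relatively non-twisted). Then there exists t₀ > 0 such that for every t ∈ (0, t₀), the set S(t) has exactly two elements, and both elements lie in ℝ × ℝ (i.e., the intersection consists of two distinct real points of multiplicity 1). -/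
open Filter Topology

/-- A real quadratic with positive discriminant has exactly two complex roots, both real. -/
lemma exists_real_roots_of_discrim_pos {a b c : ℝ} (ha : a ≠ 0) (hD : 0 < b ^ 2 - 4 * a * c) :
    ∃ x y : ℝ, x ≠ y ∧
      ∀ z : ℂ, (a : ℂ) * z ^ 2 + b * z + c = 0 ↔ z = (x : ℂ) ∨ z = (y : ℂ) := by
  set r := √(b ^ 2 - 4 * a * c) with hr
  have hr0 : 0 < r := Real.sqrt_pos.mpr hD
  have hsq : r ^ 2 = b ^ 2 - 4 * a * c := Real.sq_sqrt hD.le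
  have haC : (a : ℂ) ≠ 0 := by exact_mod_cast ha
  have hsqC : (r : ℂ) * r = discrim (a : ℂ) b c := by
    rw [discrim, ← sq]
    exact_mod_cast hsq
  refine ⟨(-b + r) / (2 * a), (-b - r) / (2 * a), ?_, fun z => ?_⟩
  · intro h
    rw [div_left_inj' (by simpa using ha)] at h
    linarith
  · rw [sq, quadratic_eq_zero_iff haC hsqC.symm]
    push_cast
    rfl

/-- The intersection of a real line with a pair of vertical lines given by a real quadratic in the
first coordinate with positive discriminant consists of two real points. -/
lemma ncard_eq_two_and_real_of_quadratic {S : Set (ℂ × ℂ)} {a b c e₀ e₁ e₂ : ℝ}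
    (ha : a ≠ 0) (hD : 0 < b ^ 2 - 4 * a * c) (he₂ : e₂ ≠ 0)
    (hS : ∀ z w : ℂ, (z, w) ∈ S ↔
      (e₀ : ℂ) + e₁ * z + e₂ * w = 0 ∧ (a : ℂ) * z ^ 2 + b * z + c = 0) :
    S.ncard = 2 ∧ ∀ zw ∈ S, zw.1.im = 0 ∧ zw.2.im = 0 := by
  obtain ⟨x, y, hxy, hroots⟩ := exists_real_roots_of_discrim_pos ha hD
  have he₂C : (e₂ : ℂ) ≠ 0 := by exact_mod_cast he₂
  have hline : ∀ z w : ℂ, (e₀ : ℂ) + e₁ * z + e₂ * w = 0 ↔ w = -(e₀ + e₁ * z) / e₂ := by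
    intro z w
    rw [eq_div_iff he₂C]
    constructor <;> intro h <;> linear_combination h
  have hSeq : S = {((x : ℂ), ((-(e₀ + e₁ * x) / e₂ : ℝ) : ℂ)),
      ((y : ℂ), ((-(e₀ + e₁ * y) / e₂ : ℝ) : ℂ))} := by
    ext ⟨z, w⟩
    rw [hS, hline, hroots]
    simp only [Set.mem_insert_iff, Set.mem_singleton_iff, Prod.mk.injEq]
    push_cast
    constructor
    · rintro ⟨rfl, rfl | rfl⟩ <;> simp
    · rintro (⟨rfl, rfl⟩ | ⟨rfl, rfl⟩) <;> simp
  rw [hSeq]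
  refine ⟨Set.ncard_pair fun h => hxy ?_, ?_⟩
  · exact Complex.ofReal_injective (congrArg Prod.fst h)
  · rintro _ (rfl | rfl) <;> exact ⟨Complex.ofReal_im _, Complex.ofReal_im _⟩

/-- The conic and line model with fixed real coefficients: two real points in the torus as soon as
the sign condition and the genericity conditions hold. -/
lemma ncard_eq_two_and_real_of_sign {M N : ℕ} (hMN : M + N = 2) {r e₀ e₁ e₂ d₁ d₂ d₃ : ℝ}
    (hr : 0 < r) (he₀ : e₀ ≠ 0) (he₁ : e₁ ≠ 0) (he₂ : e₂ ≠ 0)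
    (hd₁ : d₁ ≠ 0) (hd₂ : d₂ ≠ 0) (hd₃ : d₃ ≠ 0)
    (hPi : 0 < d₁ * d₃ * e₀ * e₂ * (-(e₁ * e₂)) ^ N)
    (hw : d₁ * r * e₀ - d₂ * e₁ ≠ 0) (hz : d₁ * r * e₀ - d₃ * e₂ ≠ 0)
    (hD : N = 2 → 0 < 4 * (d₁ * r) * e₀ * e₁ * d₂ + (d₂ * e₂ - d₃ * e₁) ^ 2)
    {S : Set (ℂ × ℂ)}
    (hS : ∀ z w : ℂ, (z, w) ∈ S ↔ z ≠ 0 ∧ w ≠ 0 ∧ (e₀ : ℂ) + e₁ * z + e₂ * w = 0 ∧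
      (d₁ : ℂ) * r * z ^ M * w ^ N + d₂ * z + d₃ * w = 0) :
    S.ncard = 2 ∧ ∀ zw ∈ S, zw.1.im = 0 ∧ zw.2.im = 0 := by
  have he₀C : (e₀ : ℂ) ≠ 0 := by exact_mod_cast he₀
  have he₁C : (e₁ : ℂ) ≠ 0 := by exact_mod_cast he₁
  have he₂C : (e₂ : ℂ) ≠ 0 := by exact_mod_cast he₂
  have hd₂C : (d₂ : ℂ) ≠ 0 := by exact_mod_cast hd₂
  have hd₃C : (d₃ : ℂ) ≠ 0 := by exact_mod_cast hd₃
  have hwC : (d₁ : ℂ) * r * e₀ - d₂ * e₁ ≠ 0 := by exact_mod_cast hw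
  have hzC : (d₁ : ℂ) * r * e₀ - d₃ * e₂ ≠ 0 := by exact_mod_cast hz
  obtain ⟨rfl, rfl⟩ | ⟨rfl, rfl⟩ | ⟨rfl, rfl⟩ :
      (M = 2 ∧ N = 0) ∨ (M = 1 ∧ N = 1) ∨ (M = 0 ∧ N = 2) := by omega
  · refine ncard_eq_two_and_real_of_quadratic (a := d₁ * r * e₂) (b := d₂ * e₂ - d₃ * e₁)
      (c := -(d₃ * e₀)) (e₀ := e₀) (e₁ := e₁) (e₂ := e₂) (by positivity) ?_ he₂ fun z w => ?_
    · have := mul_pos hPi hr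
      nlinarith [sq_nonneg (d₂ * e₂ - d₃ * e₁)]
    · rw [hS]
      push_cast
      constructor
      · rintro ⟨-, -, hl, hc⟩
        exact ⟨hl, by linear_combination e₂ * hc - d₃ * hl⟩
      · rintro ⟨hl, hc⟩
        have hc' : (d₁ : ℂ) * r * z ^ 2 * w ^ 0 + d₂ * z + d₃ * w = 0 :=
          mul_left_cancel₀ he₂C (by linear_combination hc + d₃ * hl)
        have hz0 : z ≠ 0 := by
          rintro rfl
          exact mul_ne_zero hd₃C he₀C (by linear_combination -hc)
        refine ⟨hz0, ?_, hl, hc'⟩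
        rintro rfl
        have h : (d₁ : ℂ) * r * z + d₂ = 0 :=
          mul_left_cancel₀ hz0 (by linear_combination hc')
        exact hwC (by linear_combination (d₁ : ℂ) * r * hl - e₁ * h)
  · refine ncard_eq_two_and_real_of_quadratic (a := -(d₁ * r * e₁))
      (b := d₂ * e₂ - d₃ * e₁ - d₁ * r * e₀)
      (c := -(d₃ * e₀)) (e₀ := e₀) (e₁ := e₁) (e₂ := e₂) (by
        simp [hd₁, hr.ne', he₁]) ?_ he₂ fun z w => ?_
    · have h : 0 < -(d₁ * d₃ * e₀ * e₁) := by
        refine pos_of_mul_pos_left (b := e₂ ^ 2) ?_ (sq_nonneg e₂)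
        linarith
      have := mul_pos h hr
      nlinarith [sq_nonneg (d₂ * e₂ - d₃ * e₁ - d₁ * r * e₀)]
    · rw [hS]
      push_cast
      constructor
      · rintro ⟨-, -, hl, hc⟩
        exact ⟨hl, by linear_combination e₂ * hc - (d₃ + d₁ * r * z) * hl⟩
      · rintro ⟨hl, hc⟩
        have hc' : (d₁ : ℂ) * r * z ^ 1 * w ^ 1 + d₂ * z + d₃ * w = 0 :=
          mul_left_cancel₀ he₂C (by linear_combination hc + (d₃ + d₁ * r * z) * hl)
        have hz0 : z ≠ 0 := by
          rintro rfl
          exact mul_ne_zero hd₃C he₀C (by linear_combination -hc)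
        refine ⟨hz0, ?_, hl, hc'⟩
        rintro rfl
        exact mul_ne_zero hd₂C hz0 (by linear_combination hc')
  · refine ncard_eq_two_and_real_of_quadratic (a := d₁ * r * e₁ ^ 2)
      (b := 2 * (d₁ * r) * e₀ * e₁ + e₂ * (d₂ * e₂ - d₃ * e₁))
      (c := d₁ * r * e₀ ^ 2 - e₂ * d₃ * e₀) (e₀ := e₀) (e₁ := e₁) (e₂ := e₂)
      (by positivity) ?_ he₂ fun z w => ?_
    · have := mul_pos (hD rfl) (pow_pos (abs_pos.mpr he₂) 2)
      rw [sq_abs] at this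
      linarith
    · rw [hS]
      push_cast
      constructor
      · rintro ⟨-, -, hl, hc⟩
        exact ⟨hl, by
          linear_combination e₂ ^ 2 * hc + (-e₂ * d₃ + d₁ * r * (e₀ + e₁ * z - e₂ * w)) * hl⟩
      · rintro ⟨hl, hc⟩
        have hc' : (d₁ : ℂ) * r * z ^ 0 * w ^ 2 + d₂ * z + d₃ * w = 0 :=
          mul_left_cancel₀ (pow_ne_zero 2 he₂C) (by
            linear_combination hc - (-e₂ * d₃ + d₁ * r * (e₀ + e₁ * z - e₂ * w)) * hl)
        have hz0 : z ≠ 0 := by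
          rintro rfl
          exact mul_ne_zero hzC he₀C (by linear_combination hc)
        refine ⟨hz0, ?_, hl, hc'⟩
        rintro rfl
        exact mul_ne_zero hd₂C hz0 (by linear_combination hc')

/-- Dividing the second equation of the local model by `z ^ p * w ^ q`. -/
lemma mem_Sloc2_iff {b : ℝ} {m n p q : ℕ} (hmp : p ≤ m) (hnq : q ≤ n)
    (ε₀ ε₁ ε₂ δ₁ δ₂ δ₃ : ℝ → ℝ) (t : ℝ) (z w : ℂ) :
    (z, w) ∈ Sloc2 b m n p q ε₀ ε₁ ε₂ δ₁ δ₂ δ₃ t ↔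
      z ≠ 0 ∧ w ≠ 0 ∧ (ε₀ t : ℂ) + ε₁ t * z + ε₂ t * w = 0 ∧
        (δ₁ t : ℂ) * (t ^ b : ℝ) * z ^ (m - p) * w ^ (n - q) + δ₂ t * z + δ₃ t * w = 0 := by
  simp only [Sloc2, Set.mem_ofPred_eq]
  refine and_congr_right fun hz => and_congr_right fun hw => and_congr_right fun _ => ?_
  obtain ⟨M, rfl⟩ := Nat.exists_eq_add_of_le hmp
  obtain ⟨N, rfl⟩ := Nat.exists_eq_add_of_le hnq
  rw [Nat.add_sub_cancel_left, Nat.add_sub_cancel_left]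
  have hzw : z ^ p * w ^ q ≠ 0 := mul_ne_zero (pow_ne_zero _ hz) (pow_ne_zero _ hw)
  constructor
  · intro h
    exact mul_left_cancel₀ hzw (by linear_combination h)
  · intro h
    linear_combination z ^ p * w ^ q * h

/-- If the segment `E` is relatively non-twisted
(`Π = δ₁⁰·δ₃⁰·ε₀⁰·ε₂⁰·(−ε₁⁰·ε₂⁰)^(n−q) > 0`), then for all small `t > 0` the
intersection consists of exactly two points, both real. -/
theorem segment_relatively_nontwisted_two_real_points
    (b : ℝ) (hb : 0 < b) (m n p q : ℕ)
    (h1 : m + n = p + q + 2) (hmp : p ≤ m) (hnq : q ≤ n)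
    (ε₀ ε₁ ε₂ δ₁ δ₂ δ₃ : ℝ → ℝ) (ε₀0 ε₁0 ε₂0 δ₁0 δ₂0 δ₃0 : ℝ)
    (hε₀ : Tendsto ε₀ (𝓝[>] 0) (𝓝 ε₀0)) (hε₀0 : ε₀0 ≠ 0)
    (hε₁ : Tendsto ε₁ (𝓝[>] 0) (𝓝 ε₁0)) (hε₁0 : ε₁0 ≠ 0)
    (hε₂ : Tendsto ε₂ (𝓝[>] 0) (𝓝 ε₂0)) (hε₂0 : ε₂0 ≠ 0)
    (hδ₁ : Tendsto δ₁ (𝓝[>] 0) (𝓝 δ₁0)) (hδ₁0 : δ₁0 ≠ 0)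
    (hδ₂ : Tendsto δ₂ (𝓝[>] 0) (𝓝 δ₂0)) (hδ₂0 : δ₂0 ≠ 0)
    (hδ₃ : Tendsto δ₃ (𝓝[>] 0) (𝓝 δ₃0)) (hδ₃0 : δ₃0 ≠ 0)
    (hPi : 0 < δ₁0 * δ₃0 * ε₀0 * ε₂0 * (-(ε₁0 * ε₂0)) ^ (n - q)) :
    ∃ t₀ > (0 : ℝ), ∀ t : ℝ, 0 < t → t < t₀ →
      (Sloc2 b m n p q ε₀ ε₁ ε₂ δ₁ δ₂ δ₃ t).ncard = 2 ∧
      ∀ zw ∈ Sloc2 b m n p q ε₀ ε₁ ε₂ δ₁ δ₂ δ₃ t,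
        zw.1.im = 0 ∧ zw.2.im = 0 := by
  have hr : Tendsto (fun t : ℝ => t ^ b) (𝓝[>] 0) (𝓝 0) := by
    have h := (Real.continuousAt_rpow_const 0 b (Or.inr hb.le)).tendsto
    rw [Real.zero_rpow hb.ne'] at h
    exact h.mono_left nhdsWithin_le_nhds
  have hs : Tendsto (fun t => δ₁ t * t ^ b * ε₀ t) (𝓝[>] 0) (𝓝 0) := by
    simpa using (hδ₁.mul hr).mul hε₀
  have hPit := ((((hδ₁.mul hδ₃).mul hε₀).mul hε₂).mul ((hε₁.mul hε₂).neg.pow (n - q))).eventually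
    (lt_mem_nhds hPi)
  have hw := (hs.sub (hδ₂.mul hε₁)).eventually_ne (by simp [hδ₂0, hε₁0] : _ ≠ (0 : ℝ))
  have hz := (hs.sub (hδ₃.mul hε₂)).eventually_ne (by simp [hδ₃0, hε₂0] : _ ≠ (0 : ℝ))
  have hpos : ∀ᶠ t : ℝ in 𝓝[>] 0, 0 < t ^ b := by
    filter_upwards [self_mem_nhdsWithin] with t ht using Real.rpow_pos_of_pos ht b
  have hD : n - q = 2 → ∀ᶠ t in 𝓝[>] 0, 0 < 4 * (δ₁ t * t ^ b) * ε₀ t * ε₁ t * δ₂ t +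
      (δ₂ t * ε₂ t - δ₃ t * ε₁ t) ^ 2 := by
    intro hN
    rcases eq_or_ne (δ₂0 * ε₂0) (δ₃0 * ε₁0) with hK | hK
    · have h : 0 < δ₁0 * ε₀0 * ε₁0 * δ₂0 := by
        rw [hN] at hPi
        refine pos_of_mul_pos_left (b := ε₂0 ^ 2 * ε₂0 ^ 2) ?_ (by positivity)
        calc 0 < _ := hPi
          _ = _ := by linear_combination (-δ₁0 * ε₀0 * ε₁0 * ε₂0 ^ 3) * hK
      filter_upwards [(((hδ₁.mul hε₀).mul hε₁).mul hδ₂).eventually (lt_mem_nhds h), hpos]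
        with t ht hrt
      have := mul_pos ht hrt
      nlinarith [sq_nonneg (δ₂ t * ε₂ t - δ₃ t * ε₁ t)]
    · have h := (((hs.mul hε₁).mul hδ₂).const_mul 4).add
        (((hδ₂.mul hε₂).sub (hδ₃.mul hε₁)).pow 2)
      have h0 : 0 < 4 * (0 * ε₁0 * δ₂0) + (δ₂0 * ε₂0 - δ₃0 * ε₁0) ^ 2 := by
        have := sub_ne_zero.mpr hK
        simp only [zero_mul, mul_zero, zero_add]
        positivity
      filter_upwards [h.eventually (lt_mem_nhds h0)] with t ht
      linarith
  have hev : ∀ᶠ t in 𝓝[>] 0,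
      (Sloc2 b m n p q ε₀ ε₁ ε₂ δ₁ δ₂ δ₃ t).ncard = 2 ∧
      ∀ zw ∈ Sloc2 b m n p q ε₀ ε₁ ε₂ δ₁ δ₂ δ₃ t, zw.1.im = 0 ∧ zw.2.im = 0 := by
    filter_upwards [hPit, hw, hz, hpos, eventually_imp_distrib_left.mpr hD,
      hε₀.eventually_ne hε₀0, hε₁.eventually_ne hε₁0,
      hε₂.eventually_ne hε₂0, hδ₁.eventually_ne hδ₁0, hδ₂.eventually_ne hδ₂0,
      hδ₃.eventually_ne hδ₃0] with t hPit hw hz hrt hD he₀ he₁ he₂ hd₁ hd₂ hd₃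
    exact ncard_eq_two_and_real_of_sign (by omega : (m - p) + (n - q) = 2) hrt he₀ he₁ he₂
      hd₁ hd₂ hd₃ hPit hw hz hD (mem_Sloc2_iff hmp hnq ε₀ ε₁ ε₂ δ₁ δ₂ δ₃ t)
  obtain ⟨t₀, ht₀, h⟩ := mem_nhdsGT_iff_exists_Ioo_subset.mp hev
  exact ⟨t₀, ht₀, fun t h0 h1 => h ⟨h0, h1⟩⟩
end
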